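/- arXiv:2508.05448 — 2 statements merged into one kernel-verified Lean document; each statement's English description precedes it below -/
import Mathlib

section
/- Let G be a graph and D the set of vertices of G of degree 1. If v is a vertex of G such that N(v) ∩ D = {u}, then G has an isometric path partition of minimum cardinality containing a path with u as an endpoint and of length at least 1 (i.e., with at least two vertices). -/
/-- A partition of the vertex set of `G` into paths, represented as a set of
walks (each a path) whose supports are pairwise disjoint and cover `V`. -/
def IsPathPartition {V : Type*} (G : SimpleGraph V)
    (P : Set (Σ u v : V, G.Walk u v)) : Prop :=
  (∀ p ∈ P, p.2.2.IsPath) ∧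
  (∀ x : V, ∃ p ∈ P, x ∈ p.2.2.support) ∧
  (∀ p ∈ P, ∀ q ∈ P, p ≠ q → ∀ x, x ∈ p.2.2.support → x ∉ q.2.2.support)

/-- An isometric path partition: a path partition in which every path is a
shortest path between its endpoints. -/
def IsIPPartition {V : Type*} (G : SimpleGraph V)
    (P : Set (Σ u v : V, G.Walk u v)) : Prop :=
  IsPathPartition G P ∧ ∀ p ∈ P, p.2.2.length = G.dist p.1 p.2.1

lemma aux_split {V : Type*} {G : SimpleGraph V} {a b v : V} (q : G.Walk a b)
    (hv : v ∈ q.support) (hne : v ≠ a) :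
    ∃ (x : V) (s : G.Walk a x) (hx : G.Adj x v) (r : G.Walk v b),
      q = s.append (SimpleGraph.Walk.cons hx r) := by
  induction q with
  | nil => simp at hv; exact absurd hv hne
  | @cons a c b hac q ih =>
    by_cases hvc : v = c
    · subst hvc
      exact ⟨a, SimpleGraph.Walk.nil, hac, q, by simp⟩
    · have hv' : v ∈ q.support := by
        simpa [hne] using hv
      obtain ⟨x, s, hx, r, e⟩ := ih hv' hvc
      exact ⟨x, SimpleGraph.Walk.cons hac s, hx, r, by simp [e]⟩

lemma aux_supp {V : Type*} {G : SimpleGraph V} {a b v x : V} (s : G.Walk a x) (hx : G.Adj x v)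
    (r : G.Walk v b) :
    (s.append (SimpleGraph.Walk.cons hx r)).support = s.support ++ r.support := by
  rw [SimpleGraph.Walk.support_append]; simp

lemma aux_iso {V : Type*} {G : SimpleGraph V} {a b v x : V} (s : G.Walk a x) (hx : G.Adj x v)
    (r : G.Walk v b)
    (h : (s.append (SimpleGraph.Walk.cons hx r)).length = G.dist a b) :
    s.length = G.dist a x ∧ r.length = G.dist v b := by
  obtain ⟨s', hs'⟩ := s.reachable.exists_walk_length_eq_dist
  obtain ⟨r', hr'⟩ := r.reachable.exists_walk_length_eq_dist
  have h1 := SimpleGraph.dist_le (s'.append (SimpleGraph.Walk.cons hx r'))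
  have h2 := SimpleGraph.dist_le s
  have h3 := SimpleGraph.dist_le r
  simp only [SimpleGraph.Walk.length_append, SimpleGraph.Walk.length_cons] at h h1
  omega

lemma aux_leaf {V : Type*} {G : SimpleGraph V} {u v b : V} (huv : G.Adj u v)
    (hu : ∀ c, G.Adj u c → c = v) (hb : u ≠ b) (r : G.Walk v b) (hr : r.length = G.dist v b) :
    (SimpleGraph.Walk.cons huv r).length = G.dist u b := by
  obtain ⟨w, hw⟩ := (SimpleGraph.Walk.cons huv r).reachable.exists_walk_length_eq_dist
  have h1 := SimpleGraph.dist_le (SimpleGraph.Walk.cons huv r)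
  cases w with
  | nil => exact absurd rfl hb
  | cons h' w' =>
    obtain rfl := hu _ h'
    have h2 := SimpleGraph.dist_le w'
    simp only [SimpleGraph.Walk.length_cons] at *
    omega

lemma aux_end {V : Type*} {G : SimpleGraph V} {u v a b : V}
    (hu : ∀ c, G.Adj u c → c = v) (p : G.Walk a b) (hp : p.IsPath) (hm : u ∈ p.support) :
    a = u ∨ b = u := by
  by_cases ha : u = a
  · exact Or.inl ha.symm
  obtain ⟨x, s, hx, r, rfl⟩ := aux_split p hm ha
  right
  have hn := hp.support_nodup
  rw [aux_supp, List.nodup_append] at hn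
  cases r with
  | nil => rfl
  | cons h' r' =>
    have e1 := hu _ h'
    have e2 := hu _ hx.symm
    subst e1
    subst e2
    exact absurd rfl (hn.2.2 _ s.end_mem_support _ (by simp))

lemma aux_fin {V : Type*} [Fintype V] {G : SimpleGraph V} {P : Set (Σ u v : V, G.Walk u v)}
    (hP : IsIPPartition G P) : P.Finite := by
  refine Set.Finite.of_finite_image (f := fun p => p.1) (Set.toFinite _) ?_
  intro p hp q hq e
  by_contra hne
  refine hP.1.2.2 p hp q hq hne p.1 p.2.2.start_mem_support ?_
  have : p.1 = q.1 := e
  rw [this]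
  exact q.2.2.start_mem_support

lemma aux_swap {V : Type*} [Fintype V] {G : SimpleGraph V} {P : Set (Σ u v : V, G.Walk u v)}
    (hP : IsIPPartition G P) {p q : Σ u v : V, G.Walk u v} (hp : p ∈ P) (hq : q ∈ P)
    (hpq : p ≠ q) (T : Set (Σ u v : V, G.Walk u v)) (hT2 : T.ncard ≤ 2)
    (hTp : ∀ t ∈ T, t.2.2.IsPath) (hTd : ∀ t ∈ T, t.2.2.length = G.dist t.1 t.2.1)
    (hTj : ∀ p ∈ T, ∀ q ∈ T, p ≠ q → ∀ x, x ∈ p.2.2.support → x ∉ q.2.2.support)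
    (hTs : ∀ x, (∃ t ∈ T, x ∈ t.2.2.support) ↔ x ∈ p.2.2.support ∨ x ∈ q.2.2.support) :
    IsIPPartition G ((P \ {p, q}) ∪ T) ∧ ((P \ {p, q}) ∪ T).ncard ≤ P.ncard := by
  have hfin := aux_fin hP
  have key : ∀ a ∈ P \ {p, q}, ∀ t ∈ T, ∀ x, x ∈ a.2.2.support → x ∈ t.2.2.support → False := by
    rintro a ⟨ha, hna⟩ t ht x hxa hxt
    simp only [Set.mem_insert_iff, Set.mem_singleton_iff, not_or] at hna
    rcases (hTs x).1 ⟨t, ht, hxt⟩ with h | h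
    · exact hP.1.2.2 a ha p hp hna.1 x hxa h
    · exact hP.1.2.2 a ha q hq hna.2 x hxa h
  refine ⟨⟨⟨?_, ?_, ?_⟩, ?_⟩, ?_⟩
  · rintro a (ha | ha)
    · exact hP.1.1 a ha.1
    · exact hTp a ha
  · intro x
    obtain ⟨a, ha, hx⟩ := hP.1.2.1 x
    by_cases hapq : a = p ∨ a = q
    · have : ∃ t ∈ T, x ∈ t.2.2.support := by
        rw [hTs]
        rcases hapq with rfl | rfl
        · exact Or.inl hx
        · exact Or.inr hx
      obtain ⟨t, ht, hx⟩ := this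
      exact ⟨t, Or.inr ht, hx⟩
    · exact ⟨a, Or.inl ⟨ha, by simpa using hapq⟩, hx⟩
  · rintro a (ha | ha) b (hb | hb) hab x hxa hxb
    · exact hP.1.2.2 a ha.1 b hb.1 hab x hxa hxb
    · exact key a ha b hb x hxa hxb
    · exact key b hb a ha x hxb hxa
    · exact hTj a ha b hb hab x hxa hxb
  · rintro a (ha | ha)
    · exact hP.2 a ha.1
    · exact hTd a ha
  · have h1 := Set.ncard_union_le (P \ {p, q}) T
    have hsub : ({p, q} : Set _) ⊆ P := by
      rintro a (rfl | rfl)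
      · exact hp
      · exact hq
    have h2 := Set.ncard_sdiff_add_ncard_of_subset hsub hfin
    rw [Set.ncard_pair hpq] at h2
    omega

lemma aux_exists {V : Type*} (G : SimpleGraph V) : ∃ P, IsIPPartition G P := by
  refine ⟨Set.range fun x : V => ⟨x, x, SimpleGraph.Walk.nil⟩, ⟨⟨?_, ?_, ?_⟩, ?_⟩⟩
  · rintro _ ⟨x, rfl⟩; simp
  · intro x; exact ⟨_, ⟨x, rfl⟩, by simp⟩
  · rintro _ ⟨x, rfl⟩ _ ⟨y, rfl⟩ hne z hz hz'
    simp at hz hz'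
    subst hz; subst hz'; exact hne rfl
  · rintro _ ⟨x, rfl⟩; simp

lemma aux_min {V : Type*} (G : SimpleGraph V) : ∃ P, IsIPPartition G P ∧
    ∀ Q, IsIPPartition G Q → P.ncard ≤ Q.ncard := by
  classical
  have hex : ∃ n, ∃ P, IsIPPartition G P ∧ P.ncard = n :=
    let ⟨P, hP⟩ := aux_exists G
    ⟨_, P, hP, rfl⟩
  obtain ⟨P, hP, e⟩ := Nat.find_spec hex
  exact ⟨P, hP, fun Q hQ => e ▸ Nat.find_min' hex ⟨Q, hQ, rfl⟩⟩

/-- Leaf lemma: if `N(v) ∩ D = {u}` where `D` is the set of degree-1 vertices,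
then `G` has a minimum-cardinality IP-partition containing a path with `u` as an
endpoint and of length at least 1. -/
theorem stmt0 {V : Type*} [Fintype V] [DecidableEq V] (G : SimpleGraph V)
    [DecidableRel G.Adj] (u v : V)
    (h : G.neighborSet v ∩ {w | G.degree w = 1} = {u}) :
    ∃ P : Set (Σ u v : V, G.Walk u v), IsIPPartition G P ∧
      (∀ Q, IsIPPartition G Q → P.ncard ≤ Q.ncard) ∧
      ∃ p ∈ P, (p.1 = u ∨ p.2.1 = u) ∧ 1 ≤ p.2.2.length := by
  have hmem : u ∈ G.neighborSet v ∩ {w | G.degree w = 1} := by rw [h]; rfl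
  have huv : G.Adj u v := SimpleGraph.Adj.symm hmem.1
  have hu : ∀ c, G.Adj u c → c = v := by
    intro c hc
    obtain ⟨d, hd⟩ := Finset.card_eq_one.1 hmem.2
    have h1 : c ∈ G.neighborFinset u := by simpa using hc
    have h2 : v ∈ G.neighborFinset u := by simpa using huv
    rw [hd, Finset.mem_singleton] at h1 h2
    rw [h1, h2]
  obtain ⟨P, hP, hmin⟩ := aux_min G
  obtain ⟨p, hp, hup⟩ := hP.1.2.1 u
  by_cases hlen : 1 ≤ p.2.2.length
  · exact ⟨P, hP, hmin, p, hp, aux_end hu _ (hP.1.1 p hp) hup, hlen⟩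
  have hps : ∀ x, x ∈ p.2.2.support ↔ x = u := by
    obtain ⟨a, b, w⟩ := p
    cases w with
    | nil => simp at hup ⊢; subst hup; simp
    | cons _ _ => simp at hlen
  obtain ⟨q, hq, hvq⟩ := hP.1.2.1 v
  have hpq : p ≠ q := by
    rintro rfl
    exact huv.ne ((hps v).1 hvq).symm
  have huq : u ∉ q.2.2.support := hP.1.2.2 p hp q hq hpq u hup
  have hqp := hP.1.1 q hq
  have hqd := hP.2 q hq
  suffices hT : ∃ T : Set (Σ u v : V, G.Walk u v), T.ncard ≤ 2 ∧
      (∀ t ∈ T, t.2.2.IsPath) ∧ (∀ t ∈ T, t.2.2.length = G.dist t.1 t.2.1) ∧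
      (∀ p ∈ T, ∀ q ∈ T, p ≠ q → ∀ x, x ∈ p.2.2.support → x ∉ q.2.2.support) ∧
      (∀ x, (∃ t ∈ T, x ∈ t.2.2.support) ↔ x ∈ p.2.2.support ∨ x ∈ q.2.2.support) ∧
      ∃ p ∈ T, (p.1 = u ∨ p.2.1 = u) ∧ 1 ≤ p.2.2.length by
    obtain ⟨T, h1, h2, h3, h4, h5, t, ht, h6⟩ := hT
    obtain ⟨h7, h8⟩ := aux_swap hP hp hq hpq T h1 h2 h3 h4 h5
    exact ⟨_, h7, fun Q hQ => h8.trans (hmin Q hQ), t, Or.inr ht, h6⟩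
  simp only [hps]
  clear hps hpq hq hmin hup hlen hp hP
  obtain ⟨a, b, w⟩ := q
  dsimp only at *
  have hub : u ≠ b := by rintro rfl; exact huq w.end_mem_support
  by_cases hva : v = a
  · subst hva
    refine ⟨{⟨u, b, SimpleGraph.Walk.cons huv w⟩}, by simp, ?_, ?_, ?_, ?_, ?_⟩
    · rintro _ rfl
      exact hqp.cons huq
    · rintro _ rfl
      exact aux_leaf huv hu hub w hqd
    · rintro _ rfl _ rfl hne
      exact absurd rfl hne
    · intro x; simp
    · exact ⟨_, rfl, Or.inl rfl, by simp⟩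
  · obtain ⟨x, s, hx, r, rfl⟩ := aux_split w hvq hva
    obtain ⟨hs, hr⟩ := aux_iso s hx r hqd
    have hn := hqp.support_nodup
    rw [aux_supp] at hn huq
    rw [List.nodup_append] at hn
    obtain ⟨hn1, hn2, hn3⟩ := hn
    rw [List.mem_append, not_or] at huq
    have hdisj : ∀ y, y ∈ s.support → y ∈ (SimpleGraph.Walk.cons huv r).support → False := by
      intro y hy hy'
      rw [SimpleGraph.Walk.support_cons, List.mem_cons] at hy'
      rcases hy' with rfl | hy'
      · exact huq.1 hy
      · exact hn3 y hy y hy' rfl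
    refine ⟨{⟨a, x, s⟩, ⟨u, b, SimpleGraph.Walk.cons huv r⟩}, (Set.ncard_insert_le _ _).trans (by simp),
      ?_, ?_, ?_, ?_, ?_⟩
    · rintro _ (rfl | rfl)
      · exact SimpleGraph.Walk.IsPath.mk' hn1
      · exact (SimpleGraph.Walk.IsPath.mk' hn2).cons huq.2
    · rintro _ (rfl | rfl)
      · exact hs
      · exact aux_leaf huv hu hub r hr
    · rintro _ (rfl | rfl) _ (rfl | rfl) hne y hy hy'
      · exact hne rfl
      · exact hdisj y hy hy'
      · exact hdisj y hy' hy
      · exact hne rfl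
    · intro y
      simp [aux_supp]
      tauto
    · exact ⟨_, Or.inr rfl, Or.inl rfl, by simp⟩
end

section
/- Let G be a graph and D the set of vertices of G of degree 1. If v is a vertex of G such that N(v) ∩ D = {u₁, u₂} with u₁ ≠ u₂, then G has an isometric path partition of minimum cardinality containing the path (u₁, v, u₂). -/
namespace CherryAux

variable {V : Type*} [DecidableEq V] {G : SimpleGraph V}

def Iso (G : SimpleGraph V) (S : Finset V) : Prop :=
  ∃ (a b : V) (w : G.Walk a b), w.length = G.dist a b ∧ w.support.toFinset = S

theorem geo_left {a b c : V} (p : G.Walk a b) (q : G.Walk b c)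
    (h : (p.append q).length = G.dist a c) : p.length = G.dist a b := by
  obtain ⟨p', hp'⟩ := p.reachable.exists_walk_length_eq_dist
  have h1 := G.dist_le (p'.append q)
  have h2 := G.dist_le p
  simp only [SimpleGraph.Walk.length_append] at h h1
  omega

theorem geo_right {a b c : V} (p : G.Walk a b) (q : G.Walk b c)
    (h : (p.append q).length = G.dist a c) : q.length = G.dist b c := by
  obtain ⟨p', hp'⟩ := q.reachable.exists_walk_length_eq_dist
  have h1 := G.dist_le (p.append p')
  have h2 := G.dist_le q
  simp only [SimpleGraph.Walk.length_append] at h h1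
  omega

theorem tail_piece {v b : V} (w : G.Walk v b) (h : w.length = G.dist v b) :
    ∃ B : Finset V, (B = ∅ ∨ Iso G B) ∧ v ∉ B ∧ w.support.toFinset = insert v B := by
  have hp := w.isPath_of_length_eq_dist h
  cases w with
  | nil => exact ⟨∅, by simp⟩
  | cons hh q =>
    refine ⟨q.support.toFinset, Or.inr ⟨_, _, q, ?_, rfl⟩, ?_, ?_⟩
    · exact geo_right (SimpleGraph.Walk.cons hh SimpleGraph.Walk.nil) q (by simpa using h)
    · simpa using ((SimpleGraph.Walk.cons_isPath_iff _ _).1 hp).2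
    · simp

theorem split {S : Finset V} (hS : Iso G S) {v : V} (hv : v ∈ S) :
    ∃ A B : Finset V, (A = ∅ ∨ Iso G A) ∧ (B = ∅ ∨ Iso G B) ∧ v ∉ A ∧ v ∉ B ∧
      Disjoint A B ∧ S = insert v (A ∪ B) := by
  obtain ⟨a, b, w, hw, rfl⟩ := hS
  have hv' : v ∈ w.support := by simpa using hv
  have hp := w.isPath_of_length_eq_dist hw
  obtain ⟨t, d, rfl⟩ := SimpleGraph.Walk.mem_support_iff_exists_append.1 hv'
  have ht := geo_left t d hw
  have hd := geo_right t d hw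
  obtain ⟨A, hA, hvA, hA'⟩ := tail_piece t.reverse
    (by rw [SimpleGraph.Walk.length_reverse, ht, SimpleGraph.dist_comm])
  obtain ⟨B, hB, hvB, hB'⟩ := tail_piece d hd
  have eA : ∀ x, x ∈ t.support ↔ x = v ∨ x ∈ A := fun x => by
    have := congrArg (x ∈ ·) hA'
    simpa using this
  have eB : ∀ x, x ∈ d.support ↔ x = v ∨ x ∈ B := fun x => by
    have := congrArg (x ∈ ·) hB'
    simpa using this
  refine ⟨A, B, hA, hB, hvA, hvB, ?_, ?_⟩
  · rw [Finset.disjoint_left]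
    intro x hxA hxB
    have hn := hp.support_nodup
    rw [SimpleGraph.Walk.support_append] at hn
    have hdis := (List.nodup_append'.1 hn).2.2
    have h1 : x ∈ t.support := (eA x).2 (Or.inr hxA)
    have h2 : x ∈ d.support := (eB x).2 (Or.inr hxB)
    rw [SimpleGraph.Walk.mem_support_iff] at h2
    rcases h2 with rfl | h2
    · exact hvA hxA
    · exact hdis h1 h2
  · ext x
    simp only [List.mem_toFinset, SimpleGraph.Walk.mem_support_append_iff, eA, eB,
      Finset.mem_insert, Finset.mem_union]
    tauto

theorem leaf_walk {u v b : V} (hu : ∀ x, G.Adj u x → x = v) (w : G.Walk u b)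
    (hv : v ∉ w.support) : w.support = [u] := by
  cases w with
  | nil => rfl
  | cons hh q =>
    exfalso
    apply hv
    have := hu _ hh
    subst this
    simp

theorem leaf {S : Finset V} (hS : Iso G S) {u v : V} (hu : ∀ x, G.Adj u x → x = v)
    (huS : u ∈ S) (hv : v ∉ S) : S = {u} := by
  obtain ⟨a, b, w, hw, rfl⟩ := hS
  have hu' : u ∈ w.support := by simpa using huS
  obtain ⟨t, d, rfl⟩ := SimpleGraph.Walk.mem_support_iff_exists_append.1 hu'
  simp only [List.mem_toFinset, SimpleGraph.Walk.mem_support_append_iff, not_or] at hv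
  have h1 := leaf_walk hu t.reverse (by simpa using hv.1)
  have h2 := leaf_walk hu d hv.2
  have h1' : t.support = [u] := by simpa using h1
  ext x
  simp [SimpleGraph.Walk.mem_support_append_iff, h1', h2]

def Fam (G : SimpleGraph V) (F : Finset (Finset V)) : Prop :=
  (∀ S ∈ F, Iso G S) ∧ (∀ x, ∃ S ∈ F, x ∈ S) ∧
  (∀ S ∈ F, ∀ T ∈ F, S ≠ T → Disjoint S T)

theorem improve {u₁ u₂ v : V} (hne : u₁ ≠ u₂) (hv1 : u₁ ≠ v) (hv2 : u₂ ≠ v)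
    (h1 : ∀ x, G.Adj u₁ x → x = v) (h2 : ∀ x, G.Adj u₂ x → x = v)
    (hC : Iso G {u₁, v, u₂}) (F : Finset (Finset V)) (hF : Fam G F) :
    ∃ F' : Finset (Finset V), Fam G F' ∧ F'.card ≤ F.card ∧ {u₁, v, u₂} ∈ F' := by
  obtain ⟨hI, hcov, hdis⟩ := hF
  have huniq : ∀ S ∈ F, ∀ T ∈ F, ∀ x, x ∈ S → x ∈ T → S = T := by
    intro S hS T hT x hx hx'
    by_contra hh
    exact Finset.disjoint_left.1 (hdis S hS T hT hh) hx hx'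
  obtain ⟨S, hS, hvS⟩ := hcov v
  obtain ⟨A, B, hA, hB, hvA, hvB, hAB, hSe⟩ := split (hI S hS) hvS
  obtain ⟨S1, hS1, hu1⟩ := hcov u₁
  obtain ⟨S2, hS2, hu2⟩ := hcov u₂
  set C : Finset V := {u₁, v, u₂} with hCdef
  have leaf1 : ∀ T, Iso G T → u₁ ∈ T → v ∉ T → T = {u₁} := fun T hT a b => leaf hT h1 a b
  have leaf2 : ∀ T, Iso G T → u₂ ∈ T → v ∉ T → T = {u₂} := fun T hT a b => leaf hT h2 a b
  have subC : ∀ T, Iso G T → v ∉ T → ¬ Disjoint T C → T ⊆ C := by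
    intro T hT hvT hnd
    obtain ⟨y, hy, hyC⟩ := Finset.not_disjoint_iff.1 hnd
    simp only [hCdef, Finset.mem_insert, Finset.mem_singleton] at hyC
    rcases hyC with rfl | rfl | rfl
    · rw [leaf1 T hT hy hvT]; simp [hCdef]
    · exact absurd hy hvT
    · rw [leaf2 T hT hy hvT]; simp [hCdef]
  have hIA : ∀ x ∈ A, Iso G A := by
    rintro x hx; rcases hA with rfl | hA
    · simp at hx
    · exact hA
  have hIB : ∀ x ∈ B, Iso G B := by
    rintro x hx; rcases hB with rfl | hB
    · simp at hx
    · exact hB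
  set cl := F.filter (fun T => Disjoint T C) with hcl
  set pc := ({A, B} : Finset (Finset V)).filter (fun T => T.Nonempty ∧ Disjoint T C) with hpc
  have hAS : A ⊆ S := by rw [hSe]; intro x hx; simp [hx]
  have hBS : B ⊆ S := by rw [hSe]; intro x hx; simp [hx]
  have pcS : ∀ T ∈ pc, T ⊆ S ∧ Iso G T ∧ Disjoint T C := by
    intro T hT
    simp only [hpc, Finset.mem_filter, Finset.mem_insert, Finset.mem_singleton] at hT
    obtain ⟨rfl | rfl, ⟨x, hx⟩, hd⟩ := hT
    · exact ⟨hAS, hIA x hx, hd⟩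
    · exact ⟨hBS, hIB x hx, hd⟩
  have hSC : ¬ Disjoint S C := Finset.not_disjoint_iff.2 ⟨v, hvS, by simp [hCdef]⟩
  have hclpc : ∀ T ∈ cl, ∀ T' ∈ pc, Disjoint T T' := by
    intro T hT T' hT'
    have hT := Finset.mem_filter.1 hT
    refine Finset.disjoint_of_subset_right (pcS T' hT').1 (hdis T hT.1 S hS ?_)
    rintro rfl
    exact hSC hT.2
  refine ⟨insert C (cl ∪ pc), ⟨?_, ?_, ?_⟩, ?_, by simp⟩
  · intro T hT
    simp only [Finset.mem_insert, Finset.mem_union] at hT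
    rcases hT with rfl | hT | hT
    · exact hC
    · exact hI T (Finset.mem_filter.1 hT).1
    · exact (pcS T hT).2.1
  · intro x
    by_cases hxC : x ∈ C
    · exact ⟨C, by simp, hxC⟩
    obtain ⟨T, hT, hxT⟩ := hcov x
    by_cases hd : Disjoint T C
    · exact ⟨T, by simp [hcl, hT, hd], hxT⟩
    by_cases hvT : v ∈ T
    · have hTS := huniq T hT S hS v hvT hvS
      rw [hTS, hSe] at hxT
      simp only [Finset.mem_insert, Finset.mem_union] at hxT
      rcases hxT with rfl | hx | hx
      · simp [hCdef] at hxC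
      · refine ⟨A, ?_, hx⟩
        have : Disjoint A C := by
          by_contra hh
          exact hxC (subC A (hIA x hx) hvA hh hx)
        have hn : A.Nonempty := ⟨x, hx⟩
        simp [hpc, this, hn]
      · refine ⟨B, ?_, hx⟩
        have : Disjoint B C := by
          by_contra hh
          exact hxC (subC B (hIB x hx) hvB hh hx)
        have hn : B.Nonempty := ⟨x, hx⟩
        simp [hpc, this, hn]
    · exact absurd (subC T (hI T hT) hvT hd hxT) hxC
  · intro T hT T' hT' hTT
    simp only [Finset.mem_insert, Finset.mem_union] at hT hT'
    rcases hT with rfl | hT | hT <;> rcases hT' with rfl | hT' | hT'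
    · exact absurd rfl hTT
    · exact (Finset.mem_filter.1 hT').2.symm
    · exact (pcS _ hT').2.2.symm
    · exact (Finset.mem_filter.1 hT).2
    · exact hdis _ (Finset.mem_filter.1 hT).1 _ (Finset.mem_filter.1 hT').1 hTT
    · exact hclpc _ hT _ hT'
    · exact (pcS _ hT).2.2
    · exact (hclpc _ hT' _ hT).symm
    · have hT := (Finset.mem_filter.1 hT).1
      have hT' := (Finset.mem_filter.1 hT').1
      simp only [Finset.mem_insert, Finset.mem_singleton] at hT hT'
      rcases hT with rfl | rfl <;> rcases hT' with rfl | rfl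
      · exact absurd rfl hTT
      · exact hAB
      · exact hAB.symm
      · exact absurd rfl hTT
  · have hsum : cl.card + (F.filter (fun T => ¬ Disjoint T C)).card = F.card :=
      Finset.card_filter_add_card_filter_not _
    have hins := Finset.card_insert_le C (cl ∪ pc)
    have hun := Finset.card_union_le cl pc
    suffices hk : pc.card + 1 ≤ (F.filter (fun T => ¬ Disjoint T C)).card by omega
    have hd0 : S ∈ F.filter (fun T => ¬ Disjoint T C) := by simp [hS, hSC]
    have hd1 : S1 ∈ F.filter (fun T => ¬ Disjoint T C) := by
      simp only [Finset.mem_filter, hS1, true_and]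
      exact Finset.not_disjoint_iff.2 ⟨u₁, hu1, by simp [hCdef]⟩
    have hd2 : S2 ∈ F.filter (fun T => ¬ Disjoint T C) := by
      simp only [Finset.mem_filter, hS2, true_and]
      exact Finset.not_disjoint_iff.2 ⟨u₂, hu2, by simp [hCdef]⟩
    have u1C : u₁ ∈ C := by simp [hCdef]
    have u2C : u₂ ∈ C := by simp [hCdef]
    have hpc2 : pc.card ≤ 2 := (Finset.card_filter_le _ _).trans Finset.card_le_two
    have nA : ∀ u ∈ C, u ∈ A → pc ⊆ {B} := by
      intro u hu huA T hT
      have hT := Finset.mem_filter.1 hT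
      simp only [Finset.mem_insert, Finset.mem_singleton] at hT ⊢
      rcases hT.1 with rfl | h
      · exact absurd hu (Finset.disjoint_left.1 hT.2.2 huA)
      · exact h
    have nB : ∀ u ∈ C, u ∈ B → pc ⊆ {A} := by
      intro u hu huA T hT
      have hT := Finset.mem_filter.1 hT
      simp only [Finset.mem_insert, Finset.mem_singleton] at hT ⊢
      rcases hT.1 with h | rfl
      · exact h
      · exact absurd hu (Finset.disjoint_left.1 hT.2.2 huA)
    have mS : ∀ u, u ≠ v → u ∈ S → u ∈ A ∨ u ∈ B := by
      intro u hu h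
      rw [hSe] at h
      simpa [hu] using h
    have one : ∀ u ∈ C, u ≠ v → u ∈ S → pc.card ≤ 1 := by
      intro u hu huv huS
      rcases mS u huv huS with h | h
      · simpa using Finset.card_le_card (nA u hu h)
      · simpa using Finset.card_le_card (nB u hu h)
    by_cases c1 : u₁ ∈ S <;> by_cases c2 : u₂ ∈ S
    · have hpos : 0 < (F.filter (fun T => ¬ Disjoint T C)).card := Finset.card_pos.2 ⟨S, hd0⟩
      have : pc = ∅ := by
        rw [Finset.eq_empty_iff_forall_notMem]
        intro T hT
        have hd := (pcS T hT).2.2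
        rcases mS _ hv1 c1 with a | a <;> rcases mS _ hv2 c2 with b | b
        · have := leaf1 A (hIA _ a) a hvA
          rw [this] at b
          exact hne (Finset.mem_singleton.1 b).symm
        · have := Finset.mem_singleton.1 (nA _ u1C a hT)
          subst this
          exact Finset.disjoint_left.1 hd b u2C
        · have := Finset.mem_singleton.1 (nB _ u1C a hT)
          subst this
          exact Finset.disjoint_left.1 hd b u2C
        · have := leaf1 B (hIB _ a) a hvB
          rw [this] at b
          exact hne (Finset.mem_singleton.1 b).symm
      rw [this]
      simpa using hpos
    · have := one _ u1C hv1 c1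
      have : 1 < (F.filter (fun T => ¬ Disjoint T C)).card :=
        Finset.one_lt_card.2 ⟨S, hd0, S2, hd2, by rintro rfl; exact c2 hu2⟩
      omega
    · have := one _ u2C hv2 c2
      have : 1 < (F.filter (fun T => ¬ Disjoint T C)).card :=
        Finset.one_lt_card.2 ⟨S, hd0, S1, hd1, by rintro rfl; exact c1 hu1⟩
      omega
    · have : 2 < (F.filter (fun T => ¬ Disjoint T C)).card := by
        refine Finset.two_lt_card.2 ⟨S, hd0, S1, hd1, S2, hd2, by rintro rfl; exact c1 hu1,
          by rintro rfl; exact c2 hu2, ?_⟩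
        rintro rfl
        have hvn : v ∉ S1 := fun hh => c1 (by rw [huniq S hS S1 hS1 v hvS hh]; exact hu1)
        have := leaf1 S1 (hI _ hS1) hu1 hvn
        rw [this] at hu2
        exact hne (Finset.mem_singleton.1 hu2).symm
      omega

theorem toFam [Fintype V] (Q : Set (Σ u v : V, G.Walk u v)) (hQ : IsIPPartition G Q) :
    ∃ F, Fam G F ∧ F.card = Q.ncard := by
  classical
  obtain ⟨⟨hp, hc, hd⟩, hg⟩ := hQ
  let g : (Σ u v : V, G.Walk u v) → Finset V := fun p => p.2.2.support.toFinset
  have hinj : Set.InjOn g Q := by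
    intro p hpQ q hqQ hpq
    by_contra hne
    have h1 : p.1 ∈ p.2.2.support := p.2.2.start_mem_support
    refine hd p hpQ q hqQ hne _ h1 ?_
    have : p.1 ∈ g q := by rw [← hpq]; simpa [g] using h1
    simpa [g] using this
  refine ⟨(g '' Q).toFinset, ⟨?_, ?_, ?_⟩, ?_⟩
  · intro S hS
    obtain ⟨p, hpQ, rfl⟩ := Set.mem_toFinset.1 hS
    exact ⟨_, _, p.2.2, hg p hpQ, rfl⟩
  · intro x
    obtain ⟨p, hpQ, hx⟩ := hc x
    exact ⟨g p, Set.mem_toFinset.2 ⟨p, hpQ, rfl⟩, by simpa [g] using hx⟩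
  · intro S hS T hT hne
    obtain ⟨p, hpQ, rfl⟩ := Set.mem_toFinset.1 hS
    obtain ⟨q, hqQ, rfl⟩ := Set.mem_toFinset.1 hT
    rw [Finset.disjoint_left]
    intro x hx hx'
    refine hd p hpQ q hqQ (by rintro rfl; exact hne rfl) x ?_ ?_
    · simpa [g] using hx
    · simpa [g] using hx'
  · rw [← Set.ncard_eq_toFinset_card', Set.ncard_image_of_injOn hinj]

end CherryAux

open CherryAux in
/-- Cherry lemma: if `N(v) ∩ D = {u₁, u₂}` with `u₁ ≠ u₂`, where `D` is the set
of degree-1 vertices, then `G` has a minimum-cardinality IP-partition containing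
the path `(u₁, v, u₂)`. -/
theorem stmt1 {V : Type*} [Fintype V] [DecidableEq V] (G : SimpleGraph V)
    [DecidableRel G.Adj] (u₁ u₂ v : V) (hne : u₁ ≠ u₂)
    (h : G.neighborSet v ∩ {w | G.degree w = 1} = {u₁, u₂}) :
    ∃ P : Set (Σ u v : V, G.Walk u v), IsIPPartition G P ∧
      (∀ Q, IsIPPartition G Q → P.ncard ≤ Q.ncard) ∧
      ∃ p ∈ P, p.2.2.support = [u₁, v, u₂] := by
  classical
  have key : ∀ u, u ∈ ({u₁, u₂} : Set V) → G.Adj u v ∧ ∀ x, G.Adj u x → x = v := by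
    intro u hu
    rw [← h] at hu
    have ha : G.Adj u v := SimpleGraph.Adj.symm hu.1
    refine ⟨ha, fun x hx => ?_⟩
    have hd : G.degree u = 1 := hu.2
    exact (SimpleGraph.degree_eq_one_iff_existsUnique_adj.1 hd).unique hx ha
  obtain ⟨a1, n1⟩ := key u₁ (by simp)
  obtain ⟨a2, n2⟩ := key u₂ (by simp)
  let w : G.Walk u₁ u₂ := .cons a1 (.cons a2.symm .nil)
  have hwl : w.length = G.dist u₁ u₂ := by
    have hle : G.dist u₁ u₂ ≤ 2 := G.dist_le w
    have h0 : G.dist u₁ u₂ ≠ 0 := fun hh => hne (w.reachable.dist_eq_zero_iff.1 hh)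
    have h1 : G.dist u₁ u₂ ≠ 1 := fun hh => a2.ne (n1 _ (SimpleGraph.dist_eq_one_iff_adj.1 hh))
    have : w.length = 2 := rfl
    omega
  have hws : w.support = [u₁, v, u₂] := rfl
  have hC : Iso G {u₁, v, u₂} := ⟨_, _, w, hwl, by rw [hws]; simp⟩
  have hex : ∃ F, Fam G F := by
    refine ⟨Finset.univ.image (fun x => ({x} : Finset V)), ?_, ?_, ?_⟩
    · intro S hS
      obtain ⟨x, -, rfl⟩ := Finset.mem_image.1 hS
      exact ⟨x, x, .nil, by simp, by simp⟩
    · intro x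
      exact ⟨{x}, by simp, by simp⟩
    · intro S hS T hT hST
      obtain ⟨x, -, rfl⟩ := Finset.mem_image.1 hS
      obtain ⟨y, -, rfl⟩ := Finset.mem_image.1 hT
      rw [Finset.disjoint_singleton]
      rintro rfl
      exact hST rfl
  obtain ⟨F0, hF0⟩ := hex
  obtain ⟨F, hF, hmin⟩ := Finset.exists_min_image (Finset.univ.filter (Fam G)) Finset.card
    ⟨F0, by simpa using hF0⟩
  obtain ⟨F', hF', hcard, hCF⟩ := improve hne a1.ne a2.ne n1 n2 hC F (by simpa using hF)
  obtain ⟨hI, hcov, hdis⟩ := hF'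
  have hf : ∀ S : Finset V, ∃ p : (Σ u v : V, G.Walk u v), S ∈ F' →
      p.2.2.length = G.dist p.1 p.2.1 ∧ p.2.2.support.toFinset = S ∧
      (S = {u₁, v, u₂} → p.2.2.support = [u₁, v, u₂]) := by
    intro S
    by_cases hS : S ∈ F'
    · by_cases hSC : S = {u₁, v, u₂}
      · exact ⟨⟨_, _, w⟩, fun _ => ⟨hwl, by rw [hSC, hws]; simp, fun _ => hws⟩⟩
      · obtain ⟨a, b, q, hq, hq'⟩ := hI S hS
        exact ⟨⟨_, _, q⟩, fun _ => ⟨hq, hq', fun hh => absurd hh hSC⟩⟩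
    · exact ⟨⟨_, _, w⟩, fun hh => absurd hh hS⟩
  choose f hf using hf
  have hmem : ∀ S ∈ F', ∀ x, x ∈ (f S).2.2.support ↔ x ∈ S := by
    intro S hS x
    rw [← List.mem_toFinset, (hf S hS).2.1]
  refine ⟨f '' (F' : Set (Finset V)), ⟨⟨?_, ?_, ?_⟩, ?_⟩, ?_, f {u₁, v, u₂}, ⟨_, hCF, rfl⟩,
    (hf _ hCF).2.2 rfl⟩
  · rintro _ ⟨S, hS, rfl⟩
    exact SimpleGraph.Walk.isPath_of_length_eq_dist _ (hf S hS).1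
  · intro x
    obtain ⟨S, hS, hx⟩ := hcov x
    exact ⟨_, ⟨S, hS, rfl⟩, (hmem S hS x).2 hx⟩
  · rintro _ ⟨S, hS, rfl⟩ _ ⟨T, hT, rfl⟩ hST x hx hx'
    rw [hmem S hS] at hx
    rw [hmem T hT] at hx'
    exact Finset.disjoint_left.1 (hdis S hS T hT (by rintro rfl; exact hST rfl)) hx hx'
  · rintro _ ⟨S, hS, rfl⟩
    exact (hf S hS).1
  · intro Q hQ
    obtain ⟨FQ, hFQ, hc⟩ := toFam Q hQ
    have h1 := hmin FQ (by simpa using hFQ)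
    have h2 := Set.ncard_image_le (f := f) F'.finite_toSet
    rw [Set.ncard_coe_finset] at h2
    omega
end
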